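/- arXiv:2605.14848 — 2 statements merged into one kernel-verified Lean document; each statement's English description precedes it below -/
import Mathlib

section
/- Let m, k₁, k₂ be integers with m ≥ 9 and 2 ≤ k₁ < k₁ + 1 < k₂ ≤ ⌊(m−1)/2⌋, let g be the characteristic-type function defined from the weight classes B, C, D, and let v ∈ F₃^m with Hamming weight wt(v) = i ≥ 1. Set β = Ψ_{k₁}(i,m) − Ψ_{k₁−1}(i,m), γ = Ψ_{k₂−1}(i,m) − Ψ_{k₁}(i,m), δ = Ψ_{k₂}(i,m) − Ψ_{k₂−1}(i,m). Then the number of nonzero x ∈ F₃^m with g(x) + v·x = 0 equals 3^{m−1} − 1 − (β + γ + δ); the number with g(x) + v·x = 1 equals 3^{m−1} + β + γ; and the number with g(x) + v·x = 2 equals 3^{m−1} + δ. -/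
open Finset

/-- `ζ₃ = e^{2πi/3}`, a primitive complex cube root of unity. -/
noncomputable def zeta3 : ℂ := Complex.exp (2 * Real.pi * Complex.I / 3)

/-- `ζ₃^a` for `a ∈ F₃`. -/
noncomputable def chi (a : ZMod 3) : ℂ := zeta3 ^ a.val

/-- Standard inner product on `F₃^m`. -/
def dotp {m : ℕ} (w x : Fin m → ZMod 3) : ZMod 3 := ∑ i, w i * x i

/-- Walsh transform of `F : F₃^m → F₃`. -/
noncomputable def walsh {m : ℕ} (F : (Fin m → ZMod 3) → ZMod 3)
    (w : Fin m → ZMod 3) : ℂ :=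
  ∑ x : Fin m → ZMod 3, chi (F x - dotp w x)

/-- Ternary Krawtchouk polynomial `K_t(x,m)`. -/
def Kraw (t x m : ℕ) : ℤ :=
  ∑ j ∈ Finset.range (t + 1),
    (-1 : ℤ) ^ j * 2 ^ (t - j) * (x.choose j : ℤ) * ((m - x).choose (t - j) : ℤ)

/-- Lloyd polynomial `Ψ_k(x,m) = Σ_{t=0}^k K_t(x,m)`. -/
def Lloyd (k x m : ℕ) : ℤ := ∑ t ∈ Finset.range (k + 1), Kraw t x m

/-- `f(x) = 1` iff `x ∈ A ∪ C ∪ D`, i.e. `1 ≤ wt(x) ≤ k₂` and `wt(x) ≠ k₁`. -/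
def ffun (m k₁ k₂ : ℕ) (x : Fin m → ZMod 3) : ZMod 3 :=
  if 1 ≤ hammingNorm x ∧ hammingNorm x ≤ k₂ ∧ hammingNorm x ≠ k₁ then 1 else 0

/-- `g(x) = 1` on `B ∪ C` (i.e. `k₁ ≤ wt(x) ≤ k₂ - 1`), `g(x) = -1` on `D` (`wt(x) = k₂`). -/
def gfun (m k₁ k₂ : ℕ) (x : Fin m → ZMod 3) : ZMod 3 :=
  if k₁ ≤ hammingNorm x ∧ hammingNorm x ≤ k₂ - 1 then 1
  else if hammingNorm x = k₂ then -1 else 0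

/-- The codeword `c(u,r,v)` of `C_{f,g}` for the specific `f = ffun`, `g = gfun`. -/
def cw (m k₁ k₂ : ℕ) (u r : ZMod 3) (v : Fin m → ZMod 3) :
    {x : Fin m → ZMod 3 // x ≠ 0} → ZMod 3 :=
  fun x => u * ffun m k₁ k₂ x.1 + r * gfun m k₁ k₂ x.1 + dotp v x.1

/-- Hamming weight of the codeword `c(u,r,v)`. -/
def cwt (m k₁ k₂ : ℕ) (u r : ZMod 3) (v : Fin m → ZMod 3) : ℕ :=
  (Finset.univ.filter
    (fun x : {x : Fin m → ZMod 3 // x ≠ 0} => cw m k₁ k₂ u r v x ≠ 0)).card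

open Polynomial in
lemma coeff_one_add_C_mul_X_pow {R : Type*} [CommRing R] (r : R) (n k : ℕ) :
    ((1 + C r * X : R[X]) ^ n).coeff k = r ^ k * (n.choose k : R) := by
  have h : (1 + C r * X : R[X]) ^ n = ((1 + X : R[X]) ^ n).comp (C r * X) := by simp
  rw [h, comp_C_mul_X_coeff, coeff_one_add_X_pow, mul_comm]

lemma hammingNorm_le_card_fin {m : ℕ} (v : Fin m → ZMod 3) : hammingNorm v ≤ m := by
  simpa using hammingNorm_le_card_fintype (x := v)

lemma sum_stdAddChar_three :
    1 + ZMod.stdAddChar (1 : ZMod 3) + ZMod.stdAddChar (2 : ZMod 3) = 0 := by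
  have h : ∑ a : ZMod 3, ZMod.stdAddChar a = 0 := by
    refine AddChar.sum_eq_zero_of_ne_one fun h => ?_
    have := ZMod.injective_stdAddChar (N := 3) (a₁ := 1) (a₂ := 0) (by rw [h]; rfl)
    exact absurd this (by decide)
  have h3 : ∑ a : ZMod 3, ZMod.stdAddChar a
      = ZMod.stdAddChar (0 : ZMod 3) + ZMod.stdAddChar (1 : ZMod 3)
        + ZMod.stdAddChar (2 : ZMod 3) := Fin.sum_univ_three _
  rw [h3, AddChar.map_zero_eq_one] at h
  exact h

open Polynomial in
/-- The weight enumerator of `F₃^m` twisted by the additive character attached to `v`. -/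
lemma sum_stdAddChar_mul_X_pow {m : ℕ} (v : Fin m → ZMod 3) :
    ∑ x : Fin m → ZMod 3, C (ZMod.stdAddChar (dotp v x)) * X ^ hammingNorm x
      = (1 + C (-1 : ℂ) * X) ^ hammingNorm v * (1 + C (2 : ℂ) * X) ^ (m - hammingNorm v) := by
  have hfac (a : ZMod 3) :
      ∑ b : ZMod 3, C (ZMod.stdAddChar (a * b)) * (X : ℂ[X]) ^ (if b ≠ 0 then 1 else 0)
        = if a ≠ 0 then 1 + C (-1 : ℂ) * X else 1 + C (2 : ℂ) * X := by
    have h3 (F : ZMod 3 → ℂ[X]) : ∑ b, F b = F 0 + F 1 + F 2 := Fin.sum_univ_three _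
    have h12 : C (ZMod.stdAddChar (1 : ZMod 3)) + C (ZMod.stdAddChar (2 : ZMod 3))
        = (C (-1) : ℂ[X]) := by
      rw [← C_add]; congr 1; linear_combination sum_stdAddChar_three
    have ha : a = 0 ∨ a = 1 ∨ a = 2 := by revert a; decide
    have h10 : (1 : ZMod 3) ≠ 0 := by decide
    have h20 : (2 : ZMod 3) ≠ 0 := by decide
    have h22 : (2 : ZMod 3) * 2 = 1 := by decide
    rw [h3]
    rcases ha with rfl | rfl | rfl
    · simp [h20, C_ofNat]; ring
    · simp only [ne_eq, h10, h20, mul_zero, one_mul, AddChar.map_zero_eq_one, not_true_eq_false,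
        not_false_eq_true, if_true, if_false, pow_zero, pow_one, C_1]
      linear_combination X * h12
    · simp only [ne_eq, h10, h20, h22, mul_zero, mul_one, AddChar.map_zero_eq_one,
        not_true_eq_false, not_false_eq_true, if_true, if_false, pow_zero, pow_one, C_1]
      linear_combination X * h12
  have hterm (x : Fin m → ZMod 3) :
      C (ZMod.stdAddChar (dotp v x)) * (X : ℂ[X]) ^ hammingNorm x
        = ∏ j, C (ZMod.stdAddChar (v j * x j)) * (X : ℂ[X]) ^ (if x j ≠ 0 then 1 else 0) := by
    have hsum : ZMod.stdAddChar (dotp v x) = ∏ j, ZMod.stdAddChar (v j * x j) :=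
      map_prod (ZMod.stdAddChar (N := 3)).toMonoidHom
        (fun j => Multiplicative.ofAdd (v j * x j)) univ
    rw [prod_mul_distrib, prod_pow_eq_pow_sum, ← card_filter, hsum, map_prod]
    rfl
  have hprod := prod_univ_sum (fun _ : Fin m => (univ : Finset (ZMod 3)))
    fun j b => C (ZMod.stdAddChar (v j * b)) * (X : ℂ[X]) ^ (if b ≠ 0 then 1 else 0)
  rw [Fintype.piFinset_univ] at hprod
  rw [sum_congr rfl fun x _ => hterm x, ← hprod, prod_congr rfl fun j _ => hfac (v j)]
  rw [prod_ite, prod_const, prod_const]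
  have hc : #{j | ¬ v j ≠ 0} = m - hammingNorm v := by
    have := card_filter_add_card_filter_not (s := (univ : Finset (Fin m))) (fun j => v j ≠ 0)
    rw [card_univ, Fintype.card_fin] at this
    have h' : hammingNorm v = #{j | v j ≠ 0} := rfl
    omega
  rw [hc]
  rfl

open Polynomial in
lemma sum_stdAddChar_hammingNorm_eq {m : ℕ} (v : Fin m → ZMod 3) (t : ℕ) :
    ∑ x : Fin m → ZMod 3 with hammingNorm x = t, ZMod.stdAddChar (dotp v x)
      = (Kraw t (hammingNorm v) m : ℂ) := by
  have h := congrArg (fun p : ℂ[X] => p.coeff t) (sum_stdAddChar_mul_X_pow v)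
  simp only [finsetSum_coeff, coeff_C_mul_X_pow] at h
  simp only [coeff_mul, coeff_one_add_C_mul_X_pow, eq_comm (a := t)] at h
  rw [Nat.sum_antidiagonal_eq_sum_range_succ (fun a b =>
    (-1 : ℂ) ^ a * ((hammingNorm v).choose a : ℂ) * (2 ^ b * ((m - hammingNorm v).choose b : ℂ)))]
    at h
  rw [sum_filter, h, Kraw]
  push_cast
  exact sum_congr rfl fun j _ => by ring

open Polynomial in
lemma sum_stdAddChar_dotp {m : ℕ} (v : Fin m → ZMod 3) (hv : 1 ≤ hammingNorm v) :
    ∑ x : Fin m → ZMod 3, ZMod.stdAddChar (dotp v x) = 0 := by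
  have h := congrArg (eval 1) (sum_stdAddChar_mul_X_pow v)
  simpa [eval_finsetSum, Nat.one_le_iff_ne_zero.mp hv] using h

/-- The number of `x` on the hyperplane `v·x = c` whose weight satisfies `p`. -/
def sliceCard {m : ℕ} (v : Fin m → ZMod 3) (p : ℕ → Prop) [DecidablePred p] (c : ZMod 3) : ℕ :=
  #{x : Fin m → ZMod 3 | p (hammingNorm x) ∧ dotp v x = c}

section sliceCard

variable {m : ℕ} (v : Fin m → ZMod 3) (p : ℕ → Prop) [DecidablePred p]

lemma sliceCard_one_eq_two : sliceCard v p 1 = sliceCard v p 2 := by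
  have hneg (x : Fin m → ZMod 3) : hammingNorm (-x) = hammingNorm x := by
    simp [hammingNorm]
  have hdot (x : Fin m → ZMod 3) : dotp v (-x) = -dotp v x := by
    simp [dotp]
  refine card_bij (fun x _ => -x) ?_ (fun _ _ _ _ h => neg_injective h) fun x hx => ⟨-x, ?_⟩
  · intro x hx
    simp only [mem_filter, mem_univ, true_and, hneg, hdot] at hx ⊢
    exact ⟨hx.1, by rw [hx.2]; decide⟩
  · simp only [mem_filter, mem_univ, true_and, hneg, hdot, neg_neg, exists_prop, and_true] at hx ⊢
    exact ⟨hx.1, by rw [hx.2]; decide⟩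

lemma sliceCard_zero_sub_one :
    (sliceCard v p 0 : ℂ) - sliceCard v p 1
      = ∑ x : Fin m → ZMod 3 with p (hammingNorm x), ZMod.stdAddChar (dotp v x) := by
  have h3 (F : ZMod 3 → ℂ) : ∑ b, F b = F 0 + F 1 + F 2 := Fin.sum_univ_three _
  rw [← sum_fiberwise _ (dotp v), h3]
  have hc (c : ZMod 3) : ∑ x ∈ {x : Fin m → ZMod 3 | p (hammingNorm x)} with dotp v x = c,
      ZMod.stdAddChar (dotp v x) = (sliceCard v p c : ℂ) * ZMod.stdAddChar c := by
    rw [filter_filter, sum_congr rfl fun x hx => by rw [(mem_filter.mp hx).2.2], sum_const,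
      nsmul_eq_mul]
    rfl
  rw [hc, hc, hc, ← sliceCard_one_eq_two, AddChar.map_zero_eq_one]
  linear_combination -(sliceCard v p 1 : ℂ) * sum_stdAddChar_three

lemma sliceCard_Icc (a b : ℕ) (hab : a ≤ b) :
    (sliceCard v (fun w => a + 1 ≤ w ∧ w ≤ b) 0 : ℤ)
        - sliceCard v (fun w => a + 1 ≤ w ∧ w ≤ b) 1
      = Lloyd b (hammingNorm v) m - Lloyd a (hammingNorm v) m := by
  have h := sliceCard_zero_sub_one v (fun w => a + 1 ≤ w ∧ w ≤ b)
  rw [← sum_fiberwise_of_maps_to (t := Ico (a + 1) (b + 1)) (g := hammingNorm)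
    (by intro x hx; simp only [mem_filter, mem_univ, true_and, mem_Ico] at hx ⊢; omega)] at h
  have hL : Lloyd b (hammingNorm v) m - Lloyd a (hammingNorm v) m
      = ∑ t ∈ Ico (a + 1) (b + 1), Kraw t (hammingNorm v) m := by
    rw [sum_Ico_eq_sub _ (by omega)]
    rfl
  rw [hL]
  have : ((sliceCard v (fun w => a + 1 ≤ w ∧ w ≤ b) 0 : ℂ)
        - sliceCard v (fun w => a + 1 ≤ w ∧ w ≤ b) 1)
      = ∑ t ∈ Ico (a + 1) (b + 1), (Kraw t (hammingNorm v) m : ℂ) := by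
    rw [h]
    refine sum_congr rfl fun t ht => ?_
    rw [← sum_stdAddChar_hammingNorm_eq, filter_filter]
    congr 1
    ext x
    simp only [mem_filter, mem_univ, true_and, mem_Ico] at ht ⊢
    omega
  exact_mod_cast this

lemma sliceCard_true (hv : 1 ≤ hammingNorm v) (c : ZMod 3) :
    (sliceCard v (fun _ => True) c : ℤ) = 3 ^ (m - 1) := by
  have h01 : (sliceCard v (fun _ => True) 0 : ℤ) = sliceCard v (fun _ => True) 1 := by
    have h := sliceCard_zero_sub_one v (fun _ => True)
    rw [filter_true, sum_stdAddChar_dotp v hv, sub_eq_zero] at h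
    exact_mod_cast h
  have h12 := sliceCard_one_eq_two v (fun _ => True)
  have hm : m - 1 + 1 = m := by
    have := hammingNorm_le_card_fin v
    omega
  have hsum : sliceCard v (fun _ => True) 0 + sliceCard v (fun _ => True) 1
      + sliceCard v (fun _ => True) 2 = 3 ^ (m - 1) * 3 := by
    have h := card_eq_sum_card_fiberwise (s := (univ : Finset (Fin m → ZMod 3)))
      (t := (univ : Finset (ZMod 3))) (f := dotp v) (fun _ _ => by simp)
    have h3 (F : ZMod 3 → ℕ) : ∑ b, F b = F 0 + F 1 + F 2 := Fin.sum_univ_three _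
    rw [h3, card_univ, Fintype.card_fun, ZMod.card, Fintype.card_fin] at h
    rw [← pow_succ, hm, h]
    simp [sliceCard]
  have hc : c = 0 ∨ c = 1 ∨ c = 2 := by revert c; decide
  zify at h12 hsum
  rcases hc with rfl | rfl | rfl <;> linarith

lemma sliceCard_eq_zero (c : ZMod 3) :
    sliceCard v (fun w => w = 0) c = if c = 0 then 1 else 0 := by
  have h0 : dotp v 0 = 0 := by simp [dotp]
  split_ifs with hc
  · subst hc
    refine card_eq_one.mpr ⟨0, ?_⟩
    ext x
    simp only [hammingNorm_eq_zero, mem_filter, mem_univ, true_and, mem_singleton]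
    exact ⟨fun h => h.1, by rintro rfl; exact ⟨rfl, h0⟩⟩
  · refine card_eq_zero.mpr (filter_eq_empty_iff.mpr ?_)
    rintro x - ⟨hx, hd⟩
    rw [hammingNorm_eq_zero] at hx
    subst hx
    exact hc (hd.symm.trans h0)

end sliceCard

/-- Counting solutions of `g(x) + v·x = c`, relative to the hyperplane `v·x = c`. -/
lemma card_gfun_add_dotp {m k₁ k₂ : ℕ} (hk₁ : 1 ≤ k₁) (hk : k₁ < k₂)
    (v : Fin m → ZMod 3) (c : ZMod 3) :
    #{x : Fin m → ZMod 3 | x ≠ 0 ∧ gfun m k₁ k₂ x + dotp v x = c}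
        + sliceCard v (fun w => w = 0) c
        + sliceCard v (fun w => k₁ ≤ w ∧ w ≤ k₂ - 1) c + sliceCard v (fun w => k₂ ≤ w ∧ w ≤ k₂) c
      = sliceCard v (fun _ => True) c + sliceCard v (fun w => k₁ ≤ w ∧ w ≤ k₂ - 1) (c - 1)
        + sliceCard v (fun w => k₂ ≤ w ∧ w ≤ k₂) (c + 1) := by
  simp only [sliceCard, card_filter, ← sum_add_distrib]
  refine sum_congr rfl fun x _ => ?_
  simp only [← hammingNorm_ne_zero_iff, gfun]
  generalize hammingNorm x = w
  generalize dotp v x = d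
  have e1 : (1 + d = c) ↔ (d = c - 1) := by rw [eq_sub_iff_add_eq, add_comm]
  have e2 : (-1 + d = c) ↔ (d = c + 1) := by rw [neg_add_eq_iff_eq_add, add_comm]
  by_cases hA : k₁ ≤ w ∧ w ≤ k₂ - 1
  · have h0 : w ≠ 0 := by omega
    have h2 : ¬ (k₂ ≤ w ∧ w ≤ k₂) := by omega
    simp only [hA, h0, h2, e1, ne_eq, not_false_eq_true, true_and, false_and, and_self, if_true,
      if_false, add_zero]
    omega
  · by_cases hD : w = k₂
    · have h0 : w ≠ 0 := by omega
      have h2 : k₂ ≤ w ∧ w ≤ k₂ := by omega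
      rw [if_neg hA, if_pos hD]
      simp only [hA, h0, h2, e2, ne_eq, not_false_eq_true, true_and, false_and, if_false, add_zero,
        and_self]
      omega
    · have h2 : ¬ (k₂ ≤ w ∧ w ≤ k₂) := by omega
      simp only [hA, hD, h2, false_and, true_and, if_false, add_zero, zero_add]
      by_cases h0 : w = 0 <;> simp [h0]

theorem stmt9 (m k₁ k₂ : ℕ) (hm : 9 ≤ m) (hk₁ : 2 ≤ k₁) (hk : k₁ + 1 < k₂)
    (hk₂ : k₂ ≤ (m - 1) / 2)
    (v : Fin m → ZMod 3) (i : ℕ) (hi : hammingNorm v = i) (hi1 : 1 ≤ i) :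
    ((Finset.univ.filter
        (fun x : Fin m → ZMod 3 => x ≠ 0 ∧ gfun m k₁ k₂ x + dotp v x = 0)).card : ℤ)
      = 3 ^ (m - 1) - 1 - ((Lloyd k₁ i m - Lloyd (k₁ - 1) i m)
          + (Lloyd (k₂ - 1) i m - Lloyd k₁ i m) + (Lloyd k₂ i m - Lloyd (k₂ - 1) i m)) ∧
    ((Finset.univ.filter
        (fun x : Fin m → ZMod 3 => x ≠ 0 ∧ gfun m k₁ k₂ x + dotp v x = 1)).card : ℤ)
      = 3 ^ (m - 1) + ((Lloyd k₁ i m - Lloyd (k₁ - 1) i m)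
          + (Lloyd (k₂ - 1) i m - Lloyd k₁ i m)) ∧
    ((Finset.univ.filter
        (fun x : Fin m → ZMod 3 => x ≠ 0 ∧ gfun m k₁ k₂ x + dotp v x = 2)).card : ℤ)
      = 3 ^ (m - 1) + (Lloyd k₂ i m - Lloyd (k₂ - 1) i m) := by
  subst hi
  have hT := sliceCard_true v hi1
  have hcard := card_gfun_add_dotp (m := m) (k₁ := k₁) (k₂ := k₂) (by omega) (by omega) v
  have hB := sliceCard_Icc v (k₁ - 1) (k₂ - 1) (by omega)
  have hD := sliceCard_Icc v (k₂ - 1) k₂ (by omega)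
  rw [Nat.sub_add_cancel (by omega : 1 ≤ k₁)] at hB
  rw [Nat.sub_add_cancel (by omega : 1 ≤ k₂)] at hD
  have hB' := sliceCard_one_eq_two v (fun w => k₁ ≤ w ∧ w ≤ k₂ - 1)
  have hD' := sliceCard_one_eq_two v (fun w => k₂ ≤ w ∧ w ≤ k₂)
  have h0 := hcard 0
  have h1 := hcard 1
  have h2 := hcard 2
  rw [sliceCard_eq_zero, if_pos rfl, show (0 : ZMod 3) - 1 = 2 by decide, zero_add] at h0
  rw [sliceCard_eq_zero, if_neg (by decide), sub_self, show (1 : ZMod 3) + 1 = 2 by decide] at h1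
  rw [sliceCard_eq_zero, if_neg (by decide), show (2 : ZMod 3) - 1 = 1 by decide,
    show (2 : ZMod 3) + 1 = 0 by decide] at h2
  have hT0 := hT 0
  have hT1 := hT 1
  have hT2 := hT 2
  refine ⟨?_, ?_, ?_⟩ <;> omega
end

section
/- Let m, k₁, k₂ be integers with m ≥ 9 and 2 ≤ k₁ < k₁ + 1 < k₂ ≤ ⌊(m−1)/2⌋, and let f, g be the characteristic-type functions defined from the weight classes A, B, C, D. Then for every F ∈ {f, g, f+g, f−g} and all pairwise distinct vectors v₁, v₂, v₃ ∈ F₃^m satisfying v₁ + v₂ + v₃ = 0, one has Re(F̂(v₁)) + Re(F̂(v₂)) + Re(F̂(v₃)) ≠ 3^m. -/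
open Finset

theorem zeta3_re : zeta3.re = -1 / 2 := by
  have h : zeta3 = Complex.exp (((2 * Real.pi / 3 : ℝ) : ℂ) * Complex.I) := by
    unfold zeta3
    congr 1
    push_cast
    ring
  rw [h, Complex.exp_ofReal_mul_I_re, show 2 * Real.pi / 3 = Real.pi - Real.pi / 3 by ring,
    Real.cos_pi_sub, Real.cos_pi_div_three]
  norm_num

theorem zeta3_sq_re : (zeta3 ^ 2).re = -1 / 2 := by
  have h : zeta3 ^ 2 = Complex.exp (((Real.pi / 3 + Real.pi : ℝ) : ℂ) * Complex.I) := by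
    unfold zeta3
    rw [← Complex.exp_nat_mul]
    congr 1
    push_cast
    ring
  rw [h, Complex.exp_ofReal_mul_I_re, Real.cos_add_pi, Real.cos_pi_div_three]
  norm_num

theorem chi_re (a : ZMod 3) : (chi a).re = if a = 0 then 1 else -1 / 2 := by
  obtain rfl | rfl | rfl : a = 0 ∨ a = 1 ∨ a = 2 := by
    revert a; decide
  · simp [chi]
  · simpa [chi, show (1 : ZMod 3).val = 1 from rfl] using zeta3_re
  · rw [if_neg (by decide)]
    exact zeta3_sq_re

theorem chi_re_add_sub_add (a t : ZMod 3) :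
    (chi a).re + (chi (a - t)).re + (chi (a + t)).re =
      if t = 0 then 3 * (chi a).re else 0 := by
  have key : t = 0 ∨ (t ≠ 0 ∧ a = 0 ∧ a - t ≠ 0 ∧ a + t ≠ 0) ∨
      (t ≠ 0 ∧ a ≠ 0 ∧ a - t = 0 ∧ a + t ≠ 0) ∨
      (t ≠ 0 ∧ a ≠ 0 ∧ a - t ≠ 0 ∧ a + t = 0) := by
    revert a t; decide
  rcases key with rfl | ⟨h₀, h₁, h₂, h₃⟩ | ⟨h₀, h₁, h₂, h₃⟩ | ⟨h₀, h₁, h₂, h₃⟩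
  · rw [sub_zero, add_zero, if_pos rfl]
    ring
  all_goals
    simp only [chi_re, if_neg h₀]
    simp only [h₁, h₂, h₃, if_true, if_false]
    norm_num [h₀]

theorem dotp_eq_dotProduct {m : ℕ} (w x : Fin m → ZMod 3) : dotp w x = w ⬝ᵥ x := rfl

theorem hammingNorm_neg_eq {m : ℕ} (x : Fin m → ZMod 3) : hammingNorm (-x) = hammingNorm x := by
  simp [hammingNorm]

/-- A nonzero linear form vanishes on a third of `F₃^m`. -/
theorem sum_three_on_hyperplane {m : ℕ} (h : Fin m → ZMod 3) (hh : h ≠ 0) :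
    ∑ x : Fin m → ZMod 3, (if dotp h x = 0 then (3 : ℝ) else 0) = 3 ^ m := by
  obtain ⟨j, hj⟩ := Function.ne_iff.mp hh
  have hsq : ∀ a : ZMod 3, a ≠ 0 → a * a = 1 := by decide
  have he : ∀ x c, dotp h (x + Pi.single j (h j * c)) = dotp h x + c := by
    intro x c
    rw [dotp_eq_dotProduct, dotProduct_add, dotProduct_single, ← mul_assoc, hsq _ hj, one_mul,
      dotp_eq_dotProduct]
  have hshift : ∀ c, ∑ x : Fin m → ZMod 3, (if dotp h x + c = 0 then (1 : ℝ) else 0) =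
      ∑ x : Fin m → ZMod 3, (if dotp h x = 0 then (1 : ℝ) else 0) := by
    intro c
    rw [← Equiv.sum_comp (Equiv.addRight (Pi.single j (h j * c) : Fin m → ZMod 3))
      (fun x : Fin m → ZMod 3 => if dotp h x = 0 then (1 : ℝ) else 0)]
    simp only [Equiv.coe_addRight, he]
  have hone : ∀ t : ZMod 3, (if t = 0 then (1 : ℝ) else 0) + (if t + 1 = 0 then 1 else 0) +
      (if t + 2 = 0 then 1 else 0) = 1 := by
    intro t
    have : (t = 0 ∧ t + 1 ≠ 0 ∧ t + 2 ≠ 0) ∨ (t ≠ 0 ∧ t + 1 = 0 ∧ t + 2 ≠ 0) ∨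
        (t ≠ 0 ∧ t + 1 ≠ 0 ∧ t + 2 = 0) := by
      revert t; decide
    rcases this with ⟨h₁, h₂, h₃⟩ | ⟨h₁, h₂, h₃⟩ | ⟨h₁, h₂, h₃⟩
    · rw [if_pos h₁, if_neg h₂, if_neg h₃, add_zero, add_zero]
    · rw [if_neg h₁, if_pos h₂, if_neg h₃, zero_add, add_zero]
    · rw [if_neg h₁, if_neg h₂, if_pos h₃, zero_add, zero_add]
  have htot : ∑ x : Fin m → ZMod 3, ((if dotp h x = 0 then (1 : ℝ) else 0) +
      (if dotp h x + 1 = 0 then 1 else 0) + (if dotp h x + 2 = 0 then 1 else 0)) = 3 ^ m := by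
    simp [hone, ZMod.card]
  rw [sum_add_distrib, sum_add_distrib, hshift, hshift] at htot
  have hthree : ∀ x : Fin m → ZMod 3, (if dotp h x = 0 then (3 : ℝ) else 0) =
      3 * (if dotp h x = 0 then (1 : ℝ) else 0) := by
    intro x
    split_ifs <;> norm_num
  simp_rw [hthree]
  rw [← mul_sum]
  linarith

/-- Every hyperplane of `F₃^m` contains vectors of every weight `w` with `2 ≤ w < m`. -/
theorem exists_dotp_eq_zero_hammingNorm_eq {m w : ℕ} (hw : 2 ≤ w) (hwm : w < m)
    (h : Fin m → ZMod 3) : ∃ x, dotp h x = 0 ∧ hammingNorm x = w := by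
  by_cases hij : ∃ i j, i ≠ j ∧ h i ≠ 0 ∧ h j ≠ 0
  · obtain ⟨i, j, hne, hi, hj⟩ := hij
    obtain ⟨T, hsub, -, hT⟩ := exists_subsuperset_card_eq (subset_univ ({i, j} : Finset (Fin m)))
      (n := w) (by rwa [card_pair hne]) (by simpa using hwm.le)
    have hiT : i ∈ T := hsub (by simp)
    have hjT : j ∈ T := hsub (by simp)
    set y : Fin m → ZMod 3 := fun l => if l ∈ T ∧ l ≠ i ∧ l ≠ j then 1 else 0 with hy
    have hsolve : ∀ p q c : ZMod 3, p ≠ 0 → q ≠ 0 →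
        ∃ a b : ZMod 3, a ≠ 0 ∧ b ≠ 0 ∧ c + p * a + q * b = 0 := by decide
    obtain ⟨a, b, ha, hb, hab⟩ := hsolve (h i) (h j) (dotp h y) hi hj
    refine ⟨y + Pi.single i a + Pi.single j b, ?_, ?_⟩
    · rw [dotp_eq_dotProduct, dotProduct_add, dotProduct_add, dotProduct_single,
        dotProduct_single]
      exact hab
    · rw [← hT, hammingNorm]
      congr 1
      ext l
      by_cases hli : l = i
      · subst hli
        simp [hy, hne, ha, hiT]
      · by_cases hlj : l = j
        · subst hlj
          simp [hy, hli, hb, hjT]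
        · simp [hy, hli, hlj]
  · push Not at hij
    obtain ⟨i, hi⟩ : ∃ i, ∀ l, l ≠ i → h l = 0 := by
      by_cases hz : ∃ i, h i ≠ 0
      · obtain ⟨i, hi⟩ := hz
        exact ⟨i, fun l hl => hij i l hl.symm hi⟩
      · push Not at hz
        exact ⟨⟨0, by omega⟩, fun l _ => hz l⟩
    obtain ⟨T, hsub, hT⟩ := exists_subset_card_eq (s := univ.erase i) (n := w)
      (by rw [card_erase_of_mem (mem_univ i), card_univ, Fintype.card_fin]; omega)
    refine ⟨fun l => if l ∈ T then 1 else 0, sum_eq_zero fun l _ => ?_, ?_⟩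
    · by_cases hl : l ∈ T
      · simp [hi l (ne_of_mem_erase (hsub hl))]
      · simp [hl]
    · rw [← hT, hammingNorm]
      congr 1
      ext l
      simp

/-- If an even function is nonzero somewhere on the hyperplane `h^⊥`, then it is not linear there,
so the real parts of its Walsh transform over a line of direction `h` sum to less than `3^m`. -/
theorem walsh_re_add_lt {m : ℕ} (F : (Fin m → ZMod 3) → ZMod 3) (hF : ∀ x, F (-x) = F x)
    (v h : Fin m → ZMod 3) (hh : h ≠ 0) (hx : ∃ x, dotp h x = 0 ∧ F x ≠ 0) :
    (walsh F v).re + (walsh F (v + h)).re + (walsh F (v - h)).re < 3 ^ m := by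
  have hsum : (walsh F v).re + (walsh F (v + h)).re + (walsh F (v - h)).re =
      ∑ x, if dotp h x = 0 then 3 * (chi (F x - dotp v x)).re else 0 := by
    simp only [walsh, Complex.re_sum, ← sum_add_distrib]
    refine sum_congr rfl fun x _ => ?_
    rw [← chi_re_add_sub_add]
    simp only [dotp_eq_dotProduct, add_dotProduct, sub_dotProduct, sub_sub, sub_add]
  have hle : ∀ a : ZMod 3, (chi a).re ≤ 1 := by
    intro a
    rw [chi_re]
    split_ifs <;> norm_num
  have hlt : ∀ a : ZMod 3, a ≠ 0 → (chi a).re < 1 := by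
    intro a ha
    rw [chi_re, if_neg ha]
    norm_num
  rw [hsum, ← sum_three_on_hyperplane h hh]
  obtain ⟨x, hx₀, hxF⟩ := hx
  obtain ⟨y, hy₀, hy⟩ : ∃ y, dotp h y = 0 ∧ F y - dotp v y ≠ 0 := by
    by_cases hxv : F x - dotp v x = 0
    · refine ⟨-x, ?_, ?_⟩
      · rw [dotp_eq_dotProduct, dotProduct_neg, ← dotp_eq_dotProduct, hx₀, neg_zero]
      · rw [hF, dotp_eq_dotProduct, dotProduct_neg, ← dotp_eq_dotProduct]
        have : ∀ a b : ZMod 3, a ≠ 0 → a - b = 0 → a - -b ≠ 0 := by decide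
        exact this _ _ hxF hxv
    · exact ⟨x, hx₀, hxv⟩
  refine sum_lt_sum (fun x _ => ?_) ⟨y, mem_univ y, ?_⟩
  · split_ifs
    · linarith [hle (F x - dotp v x)]
    · exact le_rfl
  · rw [if_pos hy₀, if_pos hy₀]
    linarith [hlt _ hy]

theorem stmt11 (m k₁ k₂ : ℕ) (hm : 9 ≤ m) (hk₁ : 2 ≤ k₁) (hk : k₁ + 1 < k₂)
    (hk₂ : k₂ ≤ (m - 1) / 2) :
    ∀ F ∈ ({ffun m k₁ k₂, gfun m k₁ k₂, ffun m k₁ k₂ + gfun m k₁ k₂,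
        ffun m k₁ k₂ - gfun m k₁ k₂} : Set ((Fin m → ZMod 3) → ZMod 3)),
      ∀ v₁ v₂ v₃ : Fin m → ZMod 3,
        v₁ ≠ v₂ → v₁ ≠ v₃ → v₂ ≠ v₃ → v₁ + v₂ + v₃ = 0 →
        (walsh F v₁).re + (walsh F v₂).re + (walsh F v₃).re ≠ 3 ^ m := by
  have hf : ∀ x, ffun m k₁ k₂ (-x) = ffun m k₁ k₂ x := fun x => by
    simp only [ffun, hammingNorm_neg_eq]
  have hg : ∀ x, gfun m k₁ k₂ (-x) = gfun m k₁ k₂ x := fun x => by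
    simp only [gfun, hammingNorm_neg_eq]
  intro F hFmem v₁ v₂ v₃ h₁₂ _ _ hv
  have hh : v₂ - v₁ ≠ 0 := sub_ne_zero.mpr h₁₂.symm
  have hv₃ : v₃ = v₁ - (v₂ - v₁) := by
    funext i
    have hvi : v₁ i + v₂ i + v₃ i = 0 := congrFun hv i
    have : ∀ a b c : ZMod 3, a + b + c = 0 → c = a - (b - a) := by decide
    exact this _ _ _ hvi
  have key : (∀ x, F (-x) = F x) ∧ ∃ w, 2 ≤ w ∧ w < m ∧ ∀ x, hammingNorm x = w → F x ≠ 0 := by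
    rcases hFmem with rfl | rfl | rfl | rfl
    · refine ⟨hf, k₂, by omega, by omega, fun x hx => ?_⟩
      rw [ffun, hx, if_pos (by omega)]
      decide
    · refine ⟨hg, k₂, by omega, by omega, fun x hx => ?_⟩
      rw [gfun, hx, if_neg (by omega), if_pos rfl]
      decide
    all_goals
      refine ⟨fun x => by simp only [Pi.add_apply, Pi.sub_apply, hf, hg], 2, le_rfl, by omega,
        fun x hx => ?_⟩
      simp only [Pi.add_apply, Pi.sub_apply, ffun, gfun, hx]
      obtain rfl | hlt : k₁ = 2 ∨ 2 < k₁ := by omega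
      · rw [if_neg (by omega), if_pos (by omega)]
        decide
      · rw [if_pos (by omega), if_neg (by omega), if_neg (by omega)]
        decide
  obtain ⟨heven, w, hw, hwm, hne⟩ := key
  obtain ⟨x, hx₀, hxw⟩ := exists_dotp_eq_zero_hammingNorm_eq hw hwm (v₂ - v₁)
  have hlt := walsh_re_add_lt F heven v₁ (v₂ - v₁) hh ⟨x, hx₀, hne x hxw⟩
  rw [add_sub_cancel, ← hv₃] at hlt
  exact hlt.ne
end
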